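/- arXiv:1508.07729 — 3 statements merged into one kernel-verified Lean document; each statement's English description precedes it below -/
import Mathlib

section
/- (Proposition 1) If the marginal cost c is positive (a > c > 0) and γ ≥ 0, then the quantum Cournot duopoly defined by the Li–Du–Massar scheme with the refined payoff functions has a unique Nash equilibrium (x1*, x2*), given by x1* = x2* = (a−c)·cosh(γ)/(1 + 2e^{2γ}). -/
/-- Player 1's payoff in the Li–Du–Massar quantum Cournot duopoly with refined payoffs. -/
noncomputable def uQ1 (a c γ x1 x2 : ℝ) : ℝ :=
  if Real.exp γ * (x1 + x2) ≤ a then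
    (x1 * Real.cosh γ + x2 * Real.sinh γ) * (a - c - Real.exp γ * (x1 + x2))
  else -c * (x1 * Real.cosh γ + x2 * Real.sinh γ)

/-- Player 2's payoff in the Li–Du–Massar quantum Cournot duopoly with refined payoffs. -/
noncomputable def uQ2 (a c γ x1 x2 : ℝ) : ℝ :=
  if Real.exp γ * (x1 + x2) ≤ a then
    (x2 * Real.cosh γ + x1 * Real.sinh γ) * (a - c - Real.exp γ * (x1 + x2))
  else -c * (x2 * Real.cosh γ + x1 * Real.sinh γ)

theorem uQ2_eq_uQ1_swap (a c γ x y : ℝ) : uQ2 a c γ x y = uQ1 a c γ y x := by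
  simp only [uQ1, uQ2, add_comm x y]

/-- In a profile with total quantity above `a - c`, a player producing a positive quantity gains
by producing nothing. -/
theorem total_le_of_best_response {a c γ x y : ℝ} (hc : 0 < c) (hγ : 0 ≤ γ) (hx : 0 < x)
    (hy : 0 ≤ y) (hbest : ∀ z : ℝ, 0 ≤ z → uQ1 a c γ z y ≤ uQ1 a c γ x y) :
    Real.exp γ * (x + y) ≤ a - c := by
  by_contra! hlt
  have h0 := hbest 0 le_rfl
  have hC := Real.cosh_pos γ
  have hyS : 0 ≤ y * Real.sinh γ := mul_nonneg hy (Real.sinh_nonneg_iff.2 hγ)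
  have hxC : 0 < x * Real.cosh γ := mul_pos hx hC
  have hxE : 0 < Real.exp γ * x := mul_pos (Real.exp_pos γ) hx
  simp only [uQ1] at h0
  split_ifs at h0 with h1 h2 h2 <;> nlinarith

/-- First-order conditions at a best response, in complementarity form. -/
theorem first_order_of_best_response {a c γ x y : ℝ} (hx : 0 ≤ x)
    (hlt : Real.exp γ * (x + y) < a)
    (hbest : ∀ z : ℝ, 0 ≤ z → uQ1 a c γ z y ≤ uQ1 a c γ x y) :
    let D := Real.cosh γ * (a - c - Real.exp γ * (x + y)) -
      Real.exp γ * (x * Real.cosh γ + y * Real.sinh γ)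
    D ≤ 0 ∧ (0 < x → D = 0) := by
  intro D
  have hE := Real.exp_pos γ
  have hK : 0 < Real.cosh γ * Real.exp γ := mul_pos (Real.cosh_pos γ) hE
  have key : ∀ h : ℝ, 0 ≤ x + h → Real.exp γ * (x + h + y) ≤ a →
      h * D ≤ Real.cosh γ * Real.exp γ * h ^ 2 := by
    intro h h0 h1
    have hb := hbest (x + h) h0
    simp only [uQ1, if_pos h1, if_pos hlt.le] at hb
    simp only [D]
    linarith
  have hD : D ≤ 0 := by
    by_contra! hpos
    set h := min (D / (2 * (Real.cosh γ * Real.exp γ))) ((a - Real.exp γ * (x + y)) / Real.exp γ)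
    have hh0 : 0 < h := lt_min (by positivity) (div_pos (by linarith) hE)
    have h1 : h * (2 * (Real.cosh γ * Real.exp γ)) ≤ D :=
      (le_div_iff₀ (by positivity)).1 (min_le_left _ _)
    have h2 : h * Real.exp γ ≤ a - Real.exp γ * (x + y) := (le_div_iff₀ hE).1 (min_le_right _ _)
    have := key h (by linarith) (by linarith)
    nlinarith [mul_pos hh0 hpos]
  refine ⟨hD, fun hx0 => hD.antisymm ?_⟩
  by_contra! hneg
  set h := min (-D / (2 * (Real.cosh γ * Real.exp γ))) x
  have hh0 : 0 < h := lt_min (div_pos (by linarith) (by positivity)) hx0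
  have h1 : h * (2 * (Real.cosh γ * Real.exp γ)) ≤ -D :=
    (le_div_iff₀ (by positivity)).1 (min_le_left _ _)
  have h2 : h ≤ x := min_le_right _ _
  have := key (-h) (by linarith) (by nlinarith)
  nlinarith [mul_pos hh0 (neg_pos.2 hneg)]

/-- A point with nonnegative profit margin satisfying the first-order condition is a
best response. -/
theorem best_response_of_first_order {a c γ x y : ℝ} (hc : 0 < c) (hγ : 0 ≤ γ) (hx : 0 ≤ x)
    (hy : 0 ≤ y) (hle : Real.exp γ * (x + y) ≤ a - c)
    (hD : Real.cosh γ * (a - c - Real.exp γ * (x + y)) =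
      Real.exp γ * (x * Real.cosh γ + y * Real.sinh γ))
    {z : ℝ} (hz : 0 ≤ z) : uQ1 a c γ z y ≤ uQ1 a c γ x y := by
  have hC := (Real.cosh_pos γ).le
  have hS := Real.sinh_nonneg_iff.2 hγ
  have hA : 0 ≤ x * Real.cosh γ + y * Real.sinh γ := by positivity
  have hB : 0 ≤ z * Real.cosh γ + y * Real.sinh γ := by positivity
  simp only [uQ1, if_pos (show Real.exp γ * (x + y) ≤ a by linarith)]
  split_ifs with h
  · have hsq : 0 ≤ Real.cosh γ * Real.exp γ * (z - x) ^ 2 := by positivity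
    linear_combination hsq + (z - x) * hD
  · nlinarith [mul_nonneg hA (sub_nonneg.2 hle), mul_nonneg hc.le hB]

/-- (Proposition 1) For positive marginal cost, the set of Nash equilibria of the
Li–Du–Massar quantum Cournot duopoly with refined payoffs is exactly the singleton
`{(x*, x*)}` with `x* = (a-c)·cosh γ/(1 + 2e^{2γ})`. -/
theorem li_du_massar_unique_equilibrium (a c γ : ℝ) (hc : 0 < c) (hca : c < a) (hγ : 0 ≤ γ) :
    {p : ℝ × ℝ | 0 ≤ p.1 ∧ 0 ≤ p.2 ∧
        (∀ x1 : ℝ, 0 ≤ x1 → uQ1 a c γ x1 p.2 ≤ uQ1 a c γ p.1 p.2) ∧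
        (∀ x2 : ℝ, 0 ≤ x2 → uQ2 a c γ p.1 x2 ≤ uQ2 a c γ p.1 p.2)} =
      {((a - c) * Real.cosh γ / (1 + 2 * Real.exp (2 * γ)),
        (a - c) * Real.cosh γ / (1 + 2 * Real.exp (2 * γ)))} := by
  have hE := Real.exp_pos γ
  have hC := Real.cosh_pos γ
  have hS := Real.sinh_nonneg_iff.2 hγ
  have hCS := Real.cosh_add_sinh γ
  have hSC := Real.sinh_lt_cosh γ
  have hE2 : Real.exp (2 * γ) = Real.exp γ ^ 2 := by rw [← Real.exp_nat_mul]; norm_num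
  have hCE : 2 * Real.exp γ * Real.cosh γ = Real.exp γ ^ 2 + 1 := by
    rw [← hCS]
    linear_combination Real.cosh_sq γ
  have hden : 0 < 1 + 2 * Real.exp γ ^ 2 := by positivity
  rw [hE2]
  ext ⟨x, y⟩
  simp only [Set.mem_ofPred_eq, Set.mem_singleton_iff, Prod.mk.injEq, uQ2_eq_uQ1_swap]
  constructor
  · rintro ⟨hx, hy, h1, h2⟩
    have hle : Real.exp γ * (x + y) ≤ a - c := by
      rcases hx.eq_or_lt with rfl | hx0
      · rcases hy.eq_or_lt with rfl | hy0
        · simpa using hca.le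
        · rw [add_comm]
          exact total_le_of_best_response hc hγ hy0 le_rfl h2
      · exact total_le_of_best_response hc hγ hx0 hy h1
    obtain ⟨hD1, hD1'⟩ := first_order_of_best_response hx (by linarith) h1
    obtain ⟨hD2, hD2'⟩ := first_order_of_best_response hy (by linarith) h2
    have hEC : 0 < Real.exp γ * (Real.cosh γ - Real.sinh γ) := mul_pos hE (sub_pos.2 hSC)
    have hk : 0 < Real.cosh γ * (a - c) := mul_pos hC (sub_pos.2 hca)
    have hx0 : 0 < x := by
      refine hx.lt_of_ne' fun h => ?_
      subst h
      rcases hy.eq_or_lt with rfl | hy0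
      · simp only [add_zero, mul_zero, zero_mul, sub_zero] at hD1
        linarith
      · have := hD2' hy0
        nlinarith [mul_pos hEC hy0]
    have hy0 : 0 < y := by
      refine hy.lt_of_ne' fun h => ?_
      subst h
      have := hD1' hx0
      nlinarith [mul_pos hEC hx0]
    have e1 := hD1' hx0
    have e2 := hD2' hy0
    have hxy : x = y := by
      have : Real.exp γ * (Real.cosh γ - Real.sinh γ) * (x - y) = 0 := by
        linear_combination e2 - e1
      linarith [(mul_eq_zero.1 this).resolve_left hEC.ne']
    subst hxy
    have : x = (a - c) * Real.cosh γ / (1 + 2 * Real.exp γ ^ 2) := by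
      rw [eq_div_iff hden.ne']
      linear_combination -e1 - x * hCE - x * Real.exp γ * hCS
    exact ⟨this, this⟩
  · rintro ⟨rfl, rfl⟩
    set x := (a - c) * Real.cosh γ / (1 + 2 * Real.exp γ ^ 2)
    have hx0 : 0 ≤ x := div_nonneg (mul_nonneg (sub_pos.2 hca).le hC.le) hden.le
    have hxe : x * (1 + 2 * Real.exp γ ^ 2) = (a - c) * Real.cosh γ := div_mul_cancel₀ _ hden.ne'
    have hD : Real.cosh γ * (a - c - Real.exp γ * (x + x)) =
        Real.exp γ * (x * Real.cosh γ + x * Real.sinh γ) := by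
      linear_combination -hxe - x * hCE - x * Real.exp γ * hCS
    have hle : Real.exp γ * (x + x) ≤ a - c := by
      have : 0 ≤ Real.cosh γ * (a - c - Real.exp γ * (x + x)) := by rw [hD]; positivity
      linarith [nonneg_of_mul_nonneg_right this hC]
    have hbest := fun z hz => best_response_of_first_order hc hγ hx0 hx0 hle hD (z := z) hz
    exact ⟨hx0, hx0, hbest, hbest⟩
end

section
/- In the Li–Du–Massar quantum Cournot duopoly with refined payoffs, with a > c > 0 and γ ≥ 0, for every fixed x2 ∈ [0,∞) the set of maximizers of x1 ↦ u^Q_1(x1, x2) over [0,∞) is the singleton {((a−c)·cosh γ − e^{2γ}·x2)/(e^{2γ} + 1)} if x2 ≤ (a−c)·e^{−2γ}·cosh γ, and the singleton {0} if x2 > (a−c)·e^{−2γ}·cosh γ. -/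
theorem setOf_maximizers_eq_singleton {f : ℝ → ℝ} {m : ℝ} (hm : 0 ≤ m)
    (h : ∀ y, 0 ≤ y → y ≠ m → f y < f m) :
    {x : ℝ | 0 ≤ x ∧ ∀ y : ℝ, 0 ≤ y → f y ≤ f x} = {m} := by
  ext x
  simp only [Set.mem_ofPred_eq, Set.mem_singleton_iff]
  constructor
  · rintro ⟨hx, hmax⟩
    by_contra hne
    exact (h x hx hne).not_ge (hmax m hm)
  · rintro rfl
    refine ⟨hm, fun y hy => ?_⟩
    rcases eq_or_ne y x with rfl | hne
    · exact le_rfl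
    · exact (h y hy hne).le

/-- Player 1's best reply in the Li–Du–Massar quantum Cournot duopoly: for fixed `x2 ≥ 0`,
the set of maximizers of `x1 ↦ uQ1 x1 x2` over `[0,∞)` is the singleton
`{((a-c)·cosh γ - e^{2γ}·x2)/(e^{2γ}+1)}` if `x2 ≤ (a-c)·e^{-2γ}·cosh γ`, and `{0}` otherwise. -/
theorem li_du_massar_best_reply (a c γ : ℝ) (hc : 0 < c) (hca : c < a) (hγ : 0 ≤ γ)
    (x2 : ℝ) (hx2 : 0 ≤ x2) :
    (x2 ≤ (a - c) * Real.exp (-(2 * γ)) * Real.cosh γ →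
      {x1 : ℝ | 0 ≤ x1 ∧ ∀ y : ℝ, 0 ≤ y → uQ1 a c γ y x2 ≤ uQ1 a c γ x1 x2} =
        {((a - c) * Real.cosh γ - Real.exp (2 * γ) * x2) / (Real.exp (2 * γ) + 1)}) ∧
    ((a - c) * Real.exp (-(2 * γ)) * Real.cosh γ < x2 →
      {x1 : ℝ | 0 ≤ x1 ∧ ∀ y : ℝ, 0 ≤ y → uQ1 a c γ y x2 ≤ uQ1 a c γ x1 x2} = {0}) := by
  have hE1 : 1 ≤ Real.exp γ := Real.one_le_exp hγ
  have hC0 : 0 < Real.cosh γ := Real.cosh_pos γ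
  have hS0 : 0 ≤ Real.sinh γ := Real.sinh_nonneg_iff.2 hγ
  have hCS : Real.cosh γ + Real.sinh γ = Real.exp γ := Real.cosh_add_sinh γ
  have hE2 : Real.exp (2 * γ) = Real.exp γ ^ 2 := by rw [sq, ← Real.exp_add, two_mul]
  have hEC : 2 * (Real.exp γ * Real.cosh γ) = Real.exp γ ^ 2 + 1 := by
    have h1 : Real.exp γ * Real.exp (-γ) = 1 := by rw [← Real.exp_add]; simp
    rw [Real.cosh_eq]
    linear_combination h1
  have hthreshold : (a - c) * Real.exp (-(2 * γ)) * Real.cosh γ =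
      (a - c) * Real.cosh γ / Real.exp γ ^ 2 := by
    rw [Real.exp_neg, hE2]
    ring
  rw [hthreshold, hE2]
  simp only [uQ1]
  generalize Real.exp γ = E at *
  generalize Real.cosh γ = C at *
  generalize Real.sinh γ = S at *
  have hE0 : 0 < E := by linarith
  have hEC0 : 0 < E * C := mul_pos hE0 hC0
  rw [le_div_iff₀ (by positivity), div_lt_iff₀ (by positivity)]
  constructor
  · intro h
    obtain ⟨m, hm⟩ : ∃ m, m = ((a - c) * C - E ^ 2 * x2) / (E ^ 2 + 1) := ⟨_, rfl⟩
    rw [← hm]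
    have hm0 : 0 ≤ m := by
      rw [hm]
      exact div_nonneg (by linarith) (by positivity)
    rw [eq_div_iff (by positivity)] at hm
    have hmd : E * (m + x2) ≤ a - c := by
      have h1 : E * (m + x2) * (2 * C) = (a - c) * C + x2 := by
        linear_combination hm + (m + x2) * hEC
      have h2 : x2 ≤ (a - c) * C := (le_mul_of_one_le_right hx2 (one_le_pow₀ hE1)).trans h
      have h3 : E * (m + x2) * (2 * C) ≤ (a - c) * (2 * C) := by linarith
      exact le_of_mul_le_mul_right h3 (by positivity)
    have hma : E * (m + x2) ≤ a := by linarith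
    refine setOf_maximizers_eq_singleton hm0 fun y hy hne => ?_
    rw [if_pos hma]
    split_ifs with hya
    · have h1 : 0 < (y - m) ^ 2 := by
        have := sub_ne_zero.2 hne
        positivity
      have h2 : (m * C + x2 * S) * (a - c - E * (m + x2)) -
          (y * C + x2 * S) * (a - c - E * (y + x2)) = E * C * (y - m) ^ 2 := by
        linear_combination (y - m) * hm + (y - m) * m * hEC + (y - m) * E * x2 * hCS
      have h3 := mul_pos hEC0 h1
      linarith
    · have hmy : m < y := by
        have : E * (m + x2) < E * (y + x2) := by linarith
        linarith [lt_of_mul_lt_mul_left this hE0.le]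
      have hy0 : 0 < y := by linarith
      have h1 : 0 < c * (y * C + x2 * S) := by positivity
      have h2 : 0 ≤ (m * C + x2 * S) * (a - c - E * (m + x2)) :=
        mul_nonneg (by positivity) (by linarith)
      linarith
  · intro h
    refine setOf_maximizers_eq_singleton le_rfl fun y hy hne => ?_
    have hy0 : 0 < y := lt_of_le_of_ne hy hne.symm
    have hcyC : 0 < c * (y * C) := by positivity
    have hEy : 0 < E * y := by positivity
    split_ifs with hya h0a h0a
    · have h2 : (0 * C + x2 * S) * (a - c - E * (0 + x2)) -
          (y * C + x2 * S) * (a - c - E * (y + x2)) =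
          y * (E * C * y + (x2 * E ^ 2 - (a - c) * C)) := by
        linear_combination y * E * x2 * hCS
      have h3 : 0 < y * (E * C * y + (x2 * E ^ 2 - (a - c) * C)) :=
        mul_pos hy0 (add_pos (by positivity) (by linarith))
      linarith
    · exact absurd (by linarith) h0a
    · have h1 : 0 ≤ x2 * S * (a - E * (0 + x2)) :=
        mul_nonneg (by positivity) (by linarith)
      linarith
    · linarith
end

section
/- In the Li–Du–Massar quantum Cournot duopoly with refined payoffs (a > c > 0, γ ≥ 0): (i) the set of maximizers of the total payoff u^Q_1(x1,x2) + u^Q_2(x1,x2) over (x1,x2) ∈ [0,∞)² is exactly {(x1,x2) : x1, x2 ≥ 0 and x1 + x2 = (a−c)·e^{−γ}/2}, with maximal total payoff (a−c)²/4; (ii) at the symmetric maximizer x1 = x2 = (a−c)·e^{−γ}/4, each player's payoff equals (a−c)²/8. In particular, the symmetric Pareto optimal outcome is independent of γ and equals its classical value. -/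
/-- The total payoff depends only on the effective total quantity `exp γ * (x1 + x2)`. -/
theorem uQ1_add_uQ2 (a c γ x1 x2 : ℝ) :
    uQ1 a c γ x1 x2 + uQ2 a c γ x1 x2 =
      if Real.exp γ * (x1 + x2) ≤ a then
        Real.exp γ * (x1 + x2) * (a - c - Real.exp γ * (x1 + x2))
      else -c * (Real.exp γ * (x1 + x2)) := by
  unfold uQ1 uQ2
  split_ifs <;> rw [← Real.cosh_add_sinh] <;> ring

theorem uQ2_self (a c γ x : ℝ) : uQ2 a c γ x x = uQ1 a c γ x x := rfl

theorem exp_mul_eq_half_iff (a c γ s : ℝ) :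
    Real.exp γ * s = (a - c) / 2 ↔ s = (a - c) * Real.exp (-γ) / 2 := by
  have h : Real.exp γ * Real.exp (-γ) = 1 := by rw [← Real.exp_add]; simp
  constructor <;> intro hs
  · linear_combination Real.exp (-γ) * hs - s * h
  · linear_combination Real.exp γ * hs + (a - c) / 2 * h

theorem uQ1_add_uQ2_of_sum_eq {a c γ x1 x2 : ℝ} (hc : 0 < c) (hca : c < a)
    (h : x1 + x2 = (a - c) * Real.exp (-γ) / 2) :
    uQ1 a c γ x1 x2 + uQ2 a c γ x1 x2 = (a - c) ^ 2 / 4 := by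
  rw [uQ1_add_uQ2, (exp_mul_eq_half_iff a c γ _).2 h, if_pos (by linarith)]
  ring

theorem uQ1_add_uQ2_le {a c γ x1 x2 : ℝ} (hc : 0 < c) (hx1 : 0 ≤ x1) (hx2 : 0 ≤ x2) :
    uQ1 a c γ x1 x2 + uQ2 a c γ x1 x2 ≤ (a - c) ^ 2 / 4 := by
  have hs : 0 ≤ Real.exp γ * (x1 + x2) := by positivity
  rw [uQ1_add_uQ2]
  split_ifs
  · nlinarith [sq_nonneg (Real.exp γ * (x1 + x2) - (a - c) / 2)]
  · nlinarith [mul_nonneg hc.le hs, sq_nonneg (a - c)]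

theorem sum_eq_of_le_uQ1_add_uQ2 {a c γ x1 x2 : ℝ} (hc : 0 < c) (hca : c < a)
    (hx1 : 0 ≤ x1) (hx2 : 0 ≤ x2)
    (h : (a - c) ^ 2 / 4 ≤ uQ1 a c γ x1 x2 + uQ2 a c γ x1 x2) :
    x1 + x2 = (a - c) * Real.exp (-γ) / 2 := by
  have hs : 0 ≤ Real.exp γ * (x1 + x2) := by positivity
  rw [← exp_mul_eq_half_iff]
  rw [uQ1_add_uQ2] at h
  split_ifs at h
  · have hsq : (Real.exp γ * (x1 + x2) - (a - c) / 2) ^ 2 = 0 :=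
      le_antisymm (by linarith) (sq_nonneg _)
    exact sub_eq_zero.1 (pow_eq_zero_iff two_ne_zero |>.1 hsq)
  · nlinarith [mul_nonneg hc.le hs, pow_pos (sub_pos.2 hca) 2]

/-- In the Li–Du–Massar quantum Cournot duopoly with refined payoffs:
(i) the maximizers of the total payoff over `[0,∞)²` are exactly the profiles with
`x1 + x2 = (a-c)·e^{-γ}/2`, with maximal total payoff `(a-c)²/4`;
(ii) at the symmetric maximizer `x1 = x2 = (a-c)·e^{-γ}/4` each player gets `(a-c)²/8`. -/
theorem li_du_massar_pareto (a c γ : ℝ) (hc : 0 < c) (hca : c < a) (hγ : 0 ≤ γ) :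
    ({p : ℝ × ℝ | 0 ≤ p.1 ∧ 0 ≤ p.2 ∧
        ∀ y1 y2 : ℝ, 0 ≤ y1 → 0 ≤ y2 →
          uQ1 a c γ y1 y2 + uQ2 a c γ y1 y2 ≤ uQ1 a c γ p.1 p.2 + uQ2 a c γ p.1 p.2} =
      {p : ℝ × ℝ | 0 ≤ p.1 ∧ 0 ≤ p.2 ∧ p.1 + p.2 = (a - c) * Real.exp (-γ) / 2}) ∧
    (∀ x1 x2 : ℝ, 0 ≤ x1 → 0 ≤ x2 → x1 + x2 = (a - c) * Real.exp (-γ) / 2 →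
      uQ1 a c γ x1 x2 + uQ2 a c γ x1 x2 = (a - c) ^ 2 / 4) ∧
    uQ1 a c γ ((a - c) * Real.exp (-γ) / 4) ((a - c) * Real.exp (-γ) / 4) = (a - c) ^ 2 / 8 ∧
    uQ2 a c γ ((a - c) * Real.exp (-γ) / 4) ((a - c) * Real.exp (-γ) / 4) = (a - c) ^ 2 / 8 := by
  have hsymm : uQ1 a c γ ((a - c) * Real.exp (-γ) / 4) ((a - c) * Real.exp (-γ) / 4) =
      (a - c) ^ 2 / 8 := by
    have h := uQ1_add_uQ2_of_sum_eq (γ := γ) (x1 := (a - c) * Real.exp (-γ) / 4)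
      (x2 := (a - c) * Real.exp (-γ) / 4) hc hca (by ring)
    rw [uQ2_self] at h
    linarith
  refine ⟨?_, fun x1 x2 _ _ h => uQ1_add_uQ2_of_sum_eq hc hca h, hsymm,
    (uQ2_self _ _ _ _).trans hsymm⟩
  ext p
  refine and_congr_right fun h1 => and_congr_right fun h2 => ⟨fun h => ?_, fun h y1 y2 hy1 hy2 => ?_⟩
  · have hq : 0 ≤ (a - c) * Real.exp (-γ) / 4 :=
      div_nonneg (mul_nonneg (sub_pos.2 hca).le (Real.exp_pos _).le) (by norm_num)
    refine sum_eq_of_le_uQ1_add_uQ2 hc hca h1 h2 ?_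
    exact (uQ1_add_uQ2_of_sum_eq hc hca (by ring)).ge.trans (h _ _ hq hq)
  · rw [uQ1_add_uQ2_of_sum_eq hc hca h]
    exact uQ1_add_uQ2_le hc hy1 hy2
end
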